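/- Let (W,S) be a Coxeter system with length function ℓ, acting on a monoid A by monoid automorphisms a ↦ w(a). Suppose (a_s)_{s∈S} is a family of elements of A satisfying the twisted braid relations: for all distinct s, t ∈ S such that st has finite order m = m(s,t), the alternating product a_s · s(a_t) · (st)(a_s) · (sts)(a_t) · ⋯ with m factors equals the alternating product a_t · t(a_s) · (ts)(a_t) · (tst)(a_s) · ⋯ with m factors. Then there exists a unique family (R_w)_{w∈W} of elements of A such that R_1 = 1, R_s = a_s for every s ∈ S, and R_{vw} = R_v · v(R_w) whenever v, w ∈ W satisfy ℓ(vw) = ℓ(v) + ℓ(w). Moreover, for every reduced expression w = s_{i_1} s_{i_2} ⋯ s_{i_ℓ} one has R_w = a_{s_{i_1}} · s_{i_1}(a_{s_{i_2}}) · (s_{i_1}s_{i_2})(a_{s_{i_3}}) ⋯ (s_{i_1}⋯s_{i_{ℓ-1}})(a_{s_{i_ℓ}}); in particular this product does not depend on the chosen reduced expression. -/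

import Mathlib

/-- The alternating word `[i, j, i, j, ...]` of length `m`, starting with `i`. -/
def altWord {B : Type*} (i j : B) (m : ℕ) : List B :=
  List.ofFn fun k : Fin m => if Even (k : ℕ) then i else j

/-- Given a Coxeter system `cs` on `W`, an action `φ` of `W` on a monoid `A` by monoid
automorphisms, and a family `a : B → A`, the "twisted product" along a word
`ω = [i₁, …, i_ℓ]`, namely
`a_{i₁} · s_{i₁}(a_{i₂}) · (s_{i₁}s_{i₂})(a_{i₃}) ⋯ (s_{i₁}⋯s_{i_{ℓ-1}})(a_{i_ℓ})`. -/
def twistedProdWord {B W A : Type*} [Group W] [Monoid A] {M : CoxeterMatrix B}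
    (cs : CoxeterSystem M W) (φ : W →* MulAut A) (a : B → A) (ω : List B) : A :=
  (List.ofFn fun k : Fin ω.length => φ (cs.wordProd (ω.take (k : ℕ))) (a (ω.get k))).prod

namespace MatsumotoAux
open Polynomial.Chebyshev Module

noncomputable def gf {B : Type*} (M : CoxeterMatrix B) (i : B) : Dual ℝ (B →₀ ℝ) :=
  Finsupp.linearCombination ℝ (fun j => -2 * Real.cos (Real.pi / M i j))

lemma gf_single {B : Type*} (M : CoxeterMatrix B) (i j : B) :
    gf M i (Finsupp.single j 1) = -2 * Real.cos (Real.pi / M i j) := by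
  simp [gf]

lemma gf_self {B : Type*} (M : CoxeterMatrix B) (i : B) :
    gf M i (Finsupp.single i 1) = 2 := by
  simp [gf_single]

noncomputable def gr {B : Type*} (M : CoxeterMatrix B) (i : B) : (B →₀ ℝ) ≃ₗ[ℝ] (B →₀ ℝ) :=
  reflection (gf_self M i)

lemma two_cos (x : ℝ) : (-2 * Real.cos x) * (-2 * Real.cos x) - 2 = 2 * Real.cos (2 * x) := by
  rw [Real.cos_two_mul]; ring

lemma sin_ne {m : ℕ} (hm : 3 ≤ m) : Real.sin (2 * (Real.pi / m)) ≠ 0 := by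
  have h3 : (3 : ℝ) ≤ m := by exact_mod_cast hm
  have hpi := Real.pi_pos
  apply ne_of_gt
  apply Real.sin_pos_of_pos_of_lt_pi
  · positivity
  · rw [← mul_div_assoc, div_lt_iff₀ (by linarith)]; nlinarith

lemma gr_liftable {B : Type*} (M : CoxeterMatrix B) : M.IsLiftable (gr M) := by
  intro i j
  by_cases hij : i = j
  · subst hij
    have : gr M i * gr M i = 1 := by
      ext1 z
      exact involutive_reflection (gf_self M i) z
    simp [this]
  have h1 : M i j ≠ 1 := M.off_diagonal i j hij
  have ht : (2 * Real.cos (2 * (Real.pi / M i j))) =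
      gf M i (Finsupp.single j 1) * gf M j (Finsupp.single i 1) - 2 := by
    rw [gf_single, gf_single, M.symmetric j i, two_cos]
  obtain h0 | h2 | h3 : M i j = 0 ∨ M i j = 2 ∨ 3 ≤ M i j := by omega
  · simp [h0]
  · ext1 z
    unfold gr
    rw [reflection_mul_reflection_pow_apply (gf_self M i) (gf_self M j) _ z _ ht]
    rw [gf_single, gf_single, M.symmetric j i, h2]
    norm_num
    rw [mul_div_cancel₀ _ (two_ne_zero)]
    norm_num
    module
  · have hs := sin_ne h3
    ext1 z
    unfold gr
    rw [reflection_mul_reflection_pow_apply (gf_self M i) (gf_self M j) _ z _ ht]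
    have hm : (M i j : ℝ) ≠ 0 := by norm_cast; omega
    set θ := 2 * (Real.pi / M i j) with hθ
    have hmθ : M i j * θ = 2 * Real.pi := by rw [hθ]; field_simp
    obtain ⟨k, hk⟩ := Nat.even_or_odd' (M i j)
    rcases hk with hk | hk
    · have e1 : (((M i j : ℕ) : ℤ) - 2) / 2 = k - 1 := by omega
      have e2 : (((M i j : ℕ) : ℤ) - 1) / 2 = k - 1 := by omega
      have : (S ℝ (k - 1)).eval (2 * Real.cos θ) = 0 := by
        have := S_two_mul_real_cos θ (k - 1)
        have e : (((k - 1 : ℤ) : ℝ) + 1) * θ = Real.pi := by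
          rw [hk] at hmθ; push_cast at *; linarith
        rw [e, Real.sin_pi] at this
        exact (mul_eq_zero.1 this).resolve_right hs
      rw [e1, e2, this]; simp
    · have e1 : (((M i j : ℕ) : ℤ) - 2) / 2 = k - 1 := by omega
      have e2 : (((M i j : ℕ) : ℤ) - 1) / 2 = k := by omega
      have e3 : (((M i j : ℕ) : ℤ) - 3) / 2 = k - 1 := by omega
      have e4 : (((M i j : ℕ) : ℤ)) / 2 = k := by omega
      have : (S ℝ k).eval (2 * Real.cos θ) + (S ℝ (k - 1)).eval (2 * Real.cos θ) = 0 := by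
        have h1 := S_two_mul_real_cos θ (k - 1)
        have h2 := S_two_mul_real_cos θ k
        have e : (((k : ℤ) : ℝ) + 1) * θ = 2 * Real.pi - (((k - 1 : ℤ) : ℝ) + 1) * θ := by
          rw [hk] at hmθ; push_cast at *; linarith
        rw [e, Real.sin_two_pi_sub, ← h1] at h2
        have : ((S ℝ k).eval (2 * Real.cos θ) + (S ℝ (k - 1)).eval (2 * Real.cos θ))
          * Real.sin θ = 0 := by linarith
        exact (mul_eq_zero.1 this).resolve_right hs
      rw [e1, e2, e3, e4, this]; simp

lemma gr_pow_ne {B : Type*} (M : CoxeterMatrix B) {i j : B} (hij : i ≠ j) {q : ℕ} (hq : 0 < q)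
    (hqm : M i j = 0 ∨ q < M i j) : (gr M i * gr M j) ^ q ≠ 1 := by
  intro h
  have h1 : M i j ≠ 1 := M.off_diagonal i j hij
  have ht : (2 * Real.cos (2 * (Real.pi / M i j))) =
      gf M i (Finsupp.single j 1) * gf M j (Finsupp.single i 1) - 2 := by
    rw [gf_single, gf_single, M.symmetric j i, two_cos]
  have key := reflection_mul_reflection_pow_apply_self (gf_self M i) (gf_self M j) q _ ht
  change ((gr M i * gr M j) ^ q) _ = _ at key
  rw [h, LinearEquiv.coe_one, id] at key
  have hg : gf M j (Finsupp.single i 1) = -2 * Real.cos (Real.pi / M i j) := by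
    rw [gf_single, M.symmetric j i]
  rw [hg] at key
  have ki := DFunLike.congr_fun key i
  have kj := DFunLike.congr_fun key j
  simp [hij, hij.symm] at ki kj
  obtain h0 | h2 | h3 : M i j = 0 ∨ M i j = 2 ∨ 3 ≤ M i j := by omega
  · simp [h0] at kj
    omega
  · obtain rfl : q = 1 := by omega
    simp [h2] at ki
    rw [mul_div_cancel₀ _ (two_ne_zero)] at ki
    norm_num at ki
  · have hs := sin_ne h3
    have hpi := Real.pi_pos
    have h3' : (3 : ℝ) ≤ M i j := by exact_mod_cast h3
    have hm : (M i j : ℝ) ≠ 0 := by linarith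
    have hc : Real.cos (Real.pi / M i j) ≠ 0 := by
      apply ne_of_gt
      apply Real.cos_pos_of_mem_Ioo
      constructor
      · have : 0 < Real.pi / M i j := by positivity
        linarith
      · apply div_lt_div_of_pos_left <;> linarith
    set θ := 2 * (Real.pi / M i j) with hθ
    have hmθ : M i j * θ = 2 * Real.pi := by rw [hθ]; field_simp
    have kj' := kj.resolve_right hc
    have hA := S_two_mul_real_cos θ (q - 1)
    have hB := S_two_mul_real_cos θ q
    rw [kj'] at hA ki
    rw [← add_zero (Polynomial.eval _ _), ← ki] at hB
    have e : (((q - 1 : ℤ) : ℝ) + 1) * θ = q * θ := by push_cast; ring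
    rw [e, zero_mul] at hA
    have hq0 : (0 : ℝ) < q := by exact_mod_cast hq
    have hθ0 : 0 < θ := by positivity
    have hqθ : q * θ < 2 * Real.pi := by
      rw [← hmθ]
      apply mul_lt_mul_of_pos_right _ hθ0
      have : q < M i j := by omega
      exact_mod_cast this
    push_cast at hB
    rw [add_mul, Real.sin_add, ← hA] at hB
    simp at hB
    have hc1 : Real.cos (q * θ) = 1 := by
      have : (Real.cos (q * θ) - 1) * Real.sin θ = 0 := by linarith
      have := (mul_eq_zero.1 this).resolve_right hs
      linarith
    rw [Real.cos_eq_one_iff_of_lt_of_lt (by nlinarith) hqθ] at hc1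
    nlinarith

lemma simple_pow_ne {B W : Type*} [Group W] {M : CoxeterMatrix B} (cs : CoxeterSystem M W)
    {i j : B} (hij : i ≠ j) {q : ℕ} (hq : 0 < q)
    (hqm : M i j = 0 ∨ q < M i j) : (cs.simple i * cs.simple j) ^ q ≠ 1 := by
  intro h
  apply gr_pow_ne M hij hq hqm
  have := congrArg (cs.lift ⟨_, gr_liftable M⟩) h
  simpa using this

/-! ### exchange -/

def A {B : Type*} (i j : B) : ℕ → List B
  | 0 => []
  | k + 1 => i :: A j i k

lemma altWord_eq {B : Type*} (i j : B) (k : ℕ) : altWord i j k = A i j k := by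
  induction k generalizing i j with
  | zero => simp [altWord, A]
  | succ k ih =>
    rw [A, ← ih]
    simp only [altWord, List.ofFn_succ, Fin.val_zero, Even.zero, if_true, Fin.val_succ,
      Nat.even_add_one]
    congr 2
    funext x
    by_cases h : Even (x : ℕ) <;> simp [h]

lemma A_length {B : Type*} (i j : B) (k : ℕ) : (A i j k).length = k := by
  induction k generalizing i j with
  | zero => rfl
  | succ k ih => simp [A, ih]

section
variable {B W : Type*} [Group W] {M : CoxeterMatrix B} (cs : CoxeterSystem M W)

lemma lis_A (i j : B) (k : ℕ) : cs.leftInvSeq (A i j k) =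
    (List.range k).map (fun p => (cs.simple i * cs.simple j) ^ p * cs.simple i) := by
  induction k generalizing i j with
  | zero => rfl
  | succ k ih =>
    rw [A, CoxeterSystem.leftInvSeq, ih, List.range_succ_eq_map]
    simp only [List.map_cons, List.map_map, pow_zero, one_mul]
    congr 1
    apply List.map_congr_left
    intro p hp
    clear hp
    simp only [Function.comp, MulAut.conj_apply, cs.inv_simple]
    rw [Nat.succ_eq_add_one, pow_succ]
    have : cs.simple i * (cs.simple j * cs.simple i) ^ p
      = (cs.simple i * cs.simple j) ^ p * cs.simple i := by
      induction p with
      | zero => simp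
      | succ p ih => rw [pow_succ, ← mul_assoc, ih, pow_succ]; simp only [mul_assoc]
    rw [← mul_assoc, this]
    simp only [mul_assoc]

open Classical in
noncomputable def sg (i : B) : (Function.End (W × ZMod 2))ᵐᵒᵖ :=
  MulOpposite.op ((fun x => (cs.simple i * x.1 * cs.simple i,
    x.2 + if x.1 = cs.simple i then 1 else 0)) : W × ZMod 2 → W × ZMod 2)

open Classical in
lemma sg_word (ω : List B) : (ω.map (sg cs)).prod =
    MulOpposite.op (fun x => ((cs.wordProd ω)⁻¹ * x.1 * cs.wordProd ω,
      x.2 + ((cs.leftInvSeq ω).count x.1 : ZMod 2))) := by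
  induction ω with
  | nil =>
    simp
    rfl
  | cons i ω ih =>
    rw [List.map_cons, List.prod_cons, ih, sg]
    refine congrArg MulOpposite.op ?_
    funext ⟨t, e⟩
    change ((cs.wordProd ω)⁻¹ * (cs.simple i * t * cs.simple i) * cs.wordProd ω,
      (e + if t = cs.simple i then 1 else 0) +
        ((cs.leftInvSeq ω).count (cs.simple i * t * cs.simple i) : ZMod 2)) = _
    refine Prod.ext ?_ ?_
    · simp [CoxeterSystem.wordProd_cons, mul_assoc]
    · simp only [CoxeterSystem.leftInvSeq, List.count_cons]
      have : t = MulAut.conj (cs.simple i) (cs.simple i * t * cs.simple i) := by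
        simp [mul_assoc]
      have h2 : List.count t (List.map (MulAut.conj (cs.simple i)) (cs.leftInvSeq ω)) =
        List.count (cs.simple i * t * cs.simple i) (cs.leftInvSeq ω) := by
        conv_lhs => rw [this]
        exact List.count_map_of_injective _ _ (MulEquiv.injective _) _
      rw [h2]
      simp only [beq_iff_eq, eq_comm (a := t)]
      push_cast
      ring

lemma A_two_mul_prod {G : Type*} [Monoid G] (f : B → G) (i j : B) (m : ℕ) :
    ((A i j (2 * m)).map f).prod = (f i * f j) ^ m := by
  induction m with
  | zero => simp [A]
  | succ m ih =>
    rw [Nat.mul_succ]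
    simp [A, ih, pow_succ', mul_assoc]

lemma sg_liftable : M.IsLiftable (sg cs) := by
  classical
  intro i j
  rw [← A_two_mul_prod, sg_word]
  have : cs.wordProd (A i j (2 * M i j)) = 1 := by
    rw [CoxeterSystem.wordProd, A_two_mul_prod]; simp
  rw [this, lis_A, two_mul, List.range_add]
  simp only [List.map_append, List.map_map, List.count_append]
  have : ((fun p => (cs.simple i * cs.simple j) ^ p * cs.simple i) ∘ fun x => M i j + x) =
    (fun p => (cs.simple i * cs.simple j) ^ p * cs.simple i) := by
    funext p
    simp [pow_add]
  rw [this]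
  have h (n : ZMod 2) : n + n = 0 := CharTwo.add_self_eq_zero n
  simp [h]
  rfl

open Classical in
lemma count_eq {ω ω' : List B} (h : cs.wordProd ω = cs.wordProd ω') (t : W) :
    ((cs.leftInvSeq ω).count t : ZMod 2) = (cs.leftInvSeq ω').count t := by
  have e (ω : List B) : cs.lift ⟨_, sg_liftable cs⟩ (cs.wordProd ω) = (ω.map (sg cs)).prod := by
    rw [CoxeterSystem.wordProd, map_list_prod, List.map_map]
    congr 2
    funext i
    exact cs.lift_apply_simple _ i
  have := congrArg (cs.lift ⟨_, sg_liftable cs⟩) h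
  rw [e, e, sg_word, sg_word] at this
  have := congrFun (MulOpposite.op_injective this) (t, 0)
  simpa using congrArg Prod.snd this

lemma mem_lis {ω ω' : List B} (h : cs.wordProd ω = cs.wordProd ω') (h1 : cs.IsReduced ω)
    {t : W} (ht : t ∈ cs.leftInvSeq ω) : t ∈ cs.leftInvSeq ω' := by
  classical
  have := count_eq cs h t
  rw [List.count_eq_one_of_mem h1.nodup_leftInvSeq ht] at this
  by_contra hn
  rw [List.count_eq_zero_of_not_mem hn] at this
  simp at this

lemma lis_append (ω ω' : List B) : cs.leftInvSeq (ω ++ ω') =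
    cs.leftInvSeq ω ++ (cs.leftInvSeq ω').map (MulAut.conj (cs.wordProd ω)) := by
  induction ω with
  | nil => simp
  | cons i ω ih => simp [CoxeterSystem.leftInvSeq, ih, CoxeterSystem.wordProd_cons]

lemma step {i j : B} (hij : i ≠ j) {k : ℕ} (hk : M i j = 0 ∨ k < M i j) {υ ω : List B}
    (hr : cs.IsReduced (j :: ω))
    (hr' : cs.IsReduced (A i j k ++ υ))
    (h : cs.wordProd (j :: ω) = cs.wordProd (A i j k ++ υ)) :
    ∃ υ', cs.IsReduced (A j i (k + 1) ++ υ') ∧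
      cs.wordProd (A j i (k + 1) ++ υ') = cs.wordProd (j :: ω) := by
  have hm : cs.simple j ∈ cs.leftInvSeq (A i j k ++ υ) :=
    mem_lis cs h hr (by simp [CoxeterSystem.leftInvSeq])
  rw [lis_append, List.mem_append] at hm
  rcases hm with hm | hm
  · exfalso
    rw [lis_A] at hm
    simp only [List.mem_map, List.mem_range] at hm
    obtain ⟨p, hp, e⟩ := hm
    apply simple_pow_ne cs hij (q := p + 1) (by omega) (by omega)
    rw [pow_succ, ← mul_assoc, e]; simp
  · simp only [List.mem_map] at hm
    obtain ⟨t, ht, e⟩ := hm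
    obtain ⟨n, hn, rfl⟩ := List.getElem_of_mem ht
    have hn' : n < υ.length := by simpa using hn
    have h5 := cs.getD_leftInvSeq_mul_wordProd υ n
    rw [List.getD_eq_getElem _ _ hn] at h5
    have hp : cs.wordProd (A j i (k + 1) ++ υ.eraseIdx n) = cs.wordProd (j :: ω) := by
      rw [h, A, List.cons_append, CoxeterSystem.wordProd_cons, CoxeterSystem.wordProd_append,
        ← h5, CoxeterSystem.wordProd_append]
      have : cs.simple j * (cs.wordProd (A i j k) * ((cs.leftInvSeq υ)[n] * cs.wordProd υ)) =
        cs.simple j * (MulAut.conj (cs.wordProd (A i j k)) (cs.leftInvSeq υ)[n]) *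
          (cs.wordProd (A i j k) * cs.wordProd υ) := by
        simp [mul_assoc]
      rw [this, e]; simp
    refine ⟨υ.eraseIdx n, ?_, hp⟩
    unfold CoxeterSystem.IsReduced at *
    rw [hp, h, hr']
    simp [A_length, List.length_eraseIdx_of_lt hn']
    omega

/-- both at once -/
lemma steps {i j : B} (hij : i ≠ j) {ω ω' : List B} (hr : cs.IsReduced (i :: ω))
    (hr' : cs.IsReduced (j :: ω')) (h : cs.wordProd (i :: ω) = cs.wordProd (j :: ω')) (k : ℕ)
    (hk : M i j = 0 ∨ k ≤ M i j) :
    (∃ υ, cs.IsReduced (A i j k ++ υ) ∧ cs.wordProd (A i j k ++ υ) = cs.wordProd (i :: ω)) ∧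
    (∃ υ, cs.IsReduced (A j i k ++ υ) ∧ cs.wordProd (A j i k ++ υ) = cs.wordProd (i :: ω)) := by
  induction k with
  | zero => exact ⟨⟨_, hr, rfl⟩, ⟨_, hr, rfl⟩⟩
  | succ k ih =>
    obtain ⟨⟨υ, h1, h2⟩, ⟨υ', h3, h4⟩⟩ := ih (by omega)
    constructor
    · exact step cs hij.symm (by rw [M.symmetric]; omega) hr h3 h4.symm
    · rw [h]
      exact step cs hij (by omega) hr' h1 (h2.trans h).symm

lemma M_ne_zero {i j : B} (hij : i ≠ j) {ω ω' : List B} (hr : cs.IsReduced (i :: ω))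
    (hr' : cs.IsReduced (j :: ω')) (h : cs.wordProd (i :: ω) = cs.wordProd (j :: ω')) :
    M i j ≠ 0 := by
  intro h0
  obtain ⟨⟨υ, h1, h2⟩, -⟩ := steps cs hij hr hr' h (ω.length + 2) (Or.inl h0)
  unfold CoxeterSystem.IsReduced at *
  rw [h2, hr] at h1
  simp [A_length] at h1
  omega

variable {R : Type*} [Monoid R] (φ : W →* MulAut R) (a : B → R)

lemma T_nil : twistedProdWord cs φ a [] = 1 := by simp [twistedProdWord]

lemma T_cons (i : B) (ω : List B) : twistedProdWord cs φ a (i :: ω) =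
    a i * φ (cs.simple i) (twistedProdWord cs φ a ω) := by
  simp [twistedProdWord, List.ofFn_succ, map_list_prod, List.map_ofFn, Function.comp_def,
    CoxeterSystem.wordProd_cons]

lemma T_append (ω ω' : List B) : twistedProdWord cs φ a (ω ++ ω') =
    twistedProdWord cs φ a ω * φ (cs.wordProd ω) (twistedProdWord cs φ a ω') := by
  induction ω with
  | nil => simp [T_nil]
  | cons i ω ih => simp [T_cons, ih, CoxeterSystem.wordProd_cons, mul_assoc]

lemma red_tail {i : B} {ω : List B} (h : cs.IsReduced (i :: ω)) : cs.IsReduced ω := by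
  simpa using h.drop 1

lemma red_len {ω ω' : List B} (h : cs.IsReduced ω) (h' : cs.IsReduced ω')
    (e : cs.wordProd ω = cs.wordProd ω') : ω.length = ω'.length := by
  rw [← h.eq, ← h'.eq, e]

lemma wordProd_A (i j : B) : cs.wordProd (A i j (M i j)) = cs.wordProd (A j i (M i j)) := by
  have h : ∀ (k : ℕ) (i j : B), A i j k = (CoxeterSystem.alternatingWord j i k).reverse := by
    intro k
    induction k with
    | zero => intro i j; rfl
    | succ k ih => intro i j; rw [A, ih, CoxeterSystem.alternatingWord_succ]; simp
  have e := cs.wordProd_braidWord_eq j i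
  unfold CoxeterSystem.braidWord at e
  rw [M.symmetric j i] at e
  rw [h, h, CoxeterSystem.wordProd_reverse, CoxeterSystem.wordProd_reverse, e]

theorem matsumoto (hbraid : ∀ i j : B, i ≠ j → M i j ≠ 0 →
      twistedProdWord cs φ a (altWord i j (M i j)) =
        twistedProdWord cs φ a (altWord j i (M i j))) (n : ℕ) :
    ∀ ω ω' : List B, ω.length = n → cs.IsReduced ω → cs.IsReduced ω' →
      cs.wordProd ω = cs.wordProd ω' →
      twistedProdWord cs φ a ω = twistedProdWord cs φ a ω' := by
  induction n with
  | zero =>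
    intro ω ω' hn h h' e
    have := red_len cs h h' e
    rw [List.length_eq_zero_iff.1 hn, List.length_eq_zero_iff.1 (this.symm.trans hn)]
  | succ n ih =>
    have same : ∀ i ω ω', (i :: ω).length = n + 1 → cs.IsReduced (i :: ω) → cs.IsReduced (i :: ω')
        → cs.wordProd (i :: ω) = cs.wordProd (i :: ω') →
        twistedProdWord cs φ a (i :: ω) = twistedProdWord cs φ a (i :: ω') := by
      intro i ω ω' hn h h' e
      rw [T_cons, T_cons, ih ω ω' (by simpa using hn) (red_tail cs h) (red_tail cs h')
        (by simpa [CoxeterSystem.wordProd_cons] using e)]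
    intro ω ω' hn h h' e
    have hl := red_len cs h h' e
    obtain _ | ⟨i, ω⟩ := ω
    · simp at hn
    obtain _ | ⟨j, ω'⟩ := ω'
    · simp at hl
    by_cases hij : i = j
    · subst hij
      exact same _ _ _ hn h h' e
    have hM := M_ne_zero cs hij h h' e
    obtain ⟨⟨υ, h1, h2⟩, -⟩ := steps cs hij h h' e (M i j) (Or.inr le_rfl)
    have hw := wordProd_A cs i j
    have hb := hbraid i j hij hM
    rw [altWord_eq, altWord_eq] at hb
    have e3 : cs.wordProd (A j i (M i j) ++ υ) = cs.wordProd (A i j (M i j) ++ υ) := by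
      rw [CoxeterSystem.wordProd_append, CoxeterSystem.wordProd_append, hw]
    have h3 : cs.IsReduced (A j i (M i j) ++ υ) := by
      unfold CoxeterSystem.IsReduced at *
      rw [e3, h1]
      simp [A_length]
    have hT : twistedProdWord cs φ a (A i j (M i j) ++ υ) =
        twistedProdWord cs φ a (A j i (M i j) ++ υ) := by
      rw [T_append, T_append, hb, hw]
    obtain ⟨m, hm⟩ := Nat.exists_eq_succ_of_ne_zero hM
    clear hbraid hw hb
    rw [hm] at h1 h2 h3 e3 hT
    simp only [Nat.succ_eq_add_one, A, List.cons_append] at h1 h2 h3 e3 hT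
    rw [same _ _ _ hn h h1 h2.symm, hT]
    exact (same _ _ _ (hl ▸ hn) h' h3 (by rw [e3, h2, e])).symm

end
end MatsumotoAux

/-- **Existence and uniqueness of the family of `R`-matrices.**
Let `(W, S)` be a Coxeter system acting on a monoid `A` by monoid automorphisms via `φ`,
and let `(a_s)` satisfy the twisted braid relations (for distinct `s, t` with `st` of finite
order `m = M i j ≠ 0`, the two alternating twisted products of `m` factors agree).  Then there
is a unique family `(R_w)` with `R_1 = 1`, `R_s = a_s`, and `R_{vw} = R_v · v(R_w)` whenever
`ℓ(vw) = ℓ(v) + ℓ(w)`; moreover for every reduced word `ω` for `w`, `R_w` is the twisted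
product along `ω` (in particular the latter is independent of the reduced word). -/
theorem exists_unique_R_matrices {B W A : Type*} [Group W] [Monoid A] {M : CoxeterMatrix B}
    (cs : CoxeterSystem M W) (φ : W →* MulAut A) (a : B → A)
    (hbraid : ∀ i j : B, i ≠ j → M i j ≠ 0 →
      twistedProdWord cs φ a (altWord i j (M i j)) =
        twistedProdWord cs φ a (altWord j i (M i j))) :
    (∃! R : W → A,
      R 1 = 1 ∧ (∀ i : B, R (cs.simple i) = a i) ∧
      ∀ v w : W, cs.length (v * w) = cs.length v + cs.length w →
        R (v * w) = R v * φ v (R w)) ∧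
    (∀ R : W → A,
      (R 1 = 1 ∧ (∀ i : B, R (cs.simple i) = a i) ∧
        ∀ v w : W, cs.length (v * w) = cs.length v + cs.length w →
          R (v * w) = R v * φ v (R w)) →
      ∀ ω : List B, cs.IsReduced ω →
        R (cs.wordProd ω) = twistedProdWord cs φ a ω) := by
  have key : ∀ R : W → A,
      (R 1 = 1 ∧ (∀ i : B, R (cs.simple i) = a i) ∧
        ∀ v w : W, cs.length (v * w) = cs.length v + cs.length w →
          R (v * w) = R v * φ v (R w)) →
      ∀ ω : List B, cs.IsReduced ω →
        R (cs.wordProd ω) = twistedProdWord cs φ a ω := by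
    rintro R ⟨h1, h2, h3⟩ ω
    induction ω with
    | nil => intro _; simp [h1, MatsumotoAux.T_nil]
    | cons i ω ih =>
      intro h
      have h' := MatsumotoAux.red_tail cs h
      rw [MatsumotoAux.T_cons, ← ih h', CoxeterSystem.wordProd_cons, h3, h2]
      rw [← CoxeterSystem.wordProd_cons, h.eq, h'.eq, cs.length_simple, List.length_cons, add_comm]
  refine ⟨?_, key⟩
  choose f hf hf' using cs.exists_isReduced
  have mat : ∀ ω, cs.IsReduced ω →
      twistedProdWord cs φ a (f (cs.wordProd ω)) = twistedProdWord cs φ a ω := fun ω h =>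
    MatsumotoAux.matsumoto cs φ a hbraid _ _ _ rfl (hf _) h (hf' _).symm
  refine ⟨fun w => twistedProdWord cs φ a (f w), ⟨?_, ?_, ?_⟩, ?_⟩
  · have := mat [] (by simp [CoxeterSystem.IsReduced])
    simpa [MatsumotoAux.T_nil] using this
  · intro i
    have := mat [i] (by simp [CoxeterSystem.IsReduced])
    simpa [MatsumotoAux.T_nil, MatsumotoAux.T_cons] using this
  · intro v w h
    have e : v * w = cs.wordProd (f v ++ f w) := by
      rw [CoxeterSystem.wordProd_append, ← hf', ← hf']
    have hr : cs.IsReduced (f v ++ f w) := by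
      unfold CoxeterSystem.IsReduced
      rw [← e, h, List.length_append, ← (hf v).eq, ← (hf w).eq, ← hf', ← hf']
    change twistedProdWord cs φ a (f (v * w)) = _
    rw [e, mat _ hr, MatsumotoAux.T_append, ← hf']
  · intro R hR
    funext w
    conv_lhs => rw [hf' w]
    exact key R hR _ (hf w)
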